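/- Let V be a finite-dimensional complex vector space and B : V × V → ℂ a symmetric complex-bilinear form. Call a real-linear subspace W ⊆ V a real slice if W spans V over ℂ and W ∩ iW = {0} (equivalently, the canonical map W ⊗_ℝ ℂ → V is an isomorphism). Suppose W₁ and W₂ are real slices such that B is real-valued on each Wⱼ × Wⱼ and B(w, w) > 0 for every nonzero w ∈ Wⱼ (j = 1, 2). Then for every natural number k, all complex-linear functionals ℓ₁, …, ℓ_k : V → ℂ, and any choices of Lebesgue (Haar) measures μ₁ on W₁ and μ₂ on W₂, all the Gaussian integrals below converge and the normalized moments agree: (∫_{W₁} ℓ₁(x)⋯ℓ_k(x) e^{-B(x,x)/2} dμ₁(x)) / (∫_{W₁} e^{-B(x,x)/2} dμ₁(x)) = (∫_{W₂} ℓ₁(x)⋯ℓ_k(x) e^{-B(x,x)/2} dμ₂(x)) / (∫_{W₂} e^{-B(x,x)/2} dμ₂(x)). (This is the content of the paper's lemma that the perturbative series Z(λ) of a functional integral over a complex vector space is independent of the choice of real subspace V_ℝ ⊂ V on which the quadratic form is positive definite.) -/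

import Mathlib

open MeasureTheory

/-- A form which is real and positive definite on a spanning real subspace represents every
complex-linear functional. -/
lemma bilin_surjective_of_pos {V : Type*} [AddCommGroup V] [Module ℂ V]
    [FiniteDimensional ℂ V] [Module ℝ V] [IsScalarTower ℝ ℂ V]
    {E : Type*} [AddCommGroup E] [Module ℝ E]
    (B : V →ₗ[ℂ] V →ₗ[ℂ] ℂ) (f : E →ₗ[ℝ] V)
    (hspan : Submodule.span ℂ (Set.range f) = ⊤)
    (hreal : ∀ x y, (B (f x) (f y)).im = 0)
    (hpos : ∀ x, x ≠ 0 → 0 < (B (f x) (f x)).re) :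
    Function.Surjective B := by
  have hdecomp : ∀ u : V, ∃ v w : E, u = f v + Complex.I • f w := fun u => by
    have hu : u ∈ Submodule.span ℂ (Set.range f) := hspan ▸ Submodule.mem_top
    induction hu using Submodule.span_induction with
    | mem u hu =>
      obtain ⟨v, rfl⟩ := hu
      exact ⟨v, 0, by simp⟩
    | zero => exact ⟨0, 0, by simp⟩
    | add a b _ _ ha hb =>
      obtain ⟨v, w, rfl⟩ := ha
      obtain ⟨v', w', rfl⟩ := hb
      exact ⟨v + v', w + w', by simp only [map_add, smul_add]; abel⟩
    | smul c a _ ha =>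
      obtain ⟨v, w, rfl⟩ := ha
      refine ⟨c.re • v - c.im • w, c.re • w + c.im • v, ?_⟩
      have hs : ∀ (r : ℝ) (y : V), r • y = (r : ℂ) • y := fun r y => (algebraMap_smul ℂ r y).symm
      simp only [map_add, map_sub, map_smul, hs]
      match_scalars <;> apply Complex.ext <;> simp
  have hinj : Function.Injective B := by
    rw [injective_iff_map_eq_zero]
    intro u hu
    obtain ⟨v, w, rfl⟩ := hdecomp u
    have h : ∀ y, B (f v) (f y) + Complex.I * B (f w) (f y) = 0 := fun y => by
      simpa using LinearMap.congr_fun hu (f y)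
    have hv : v = 0 := by
      by_contra hv
      have := congrArg Complex.re (h v)
      simp [hreal] at this
      exact (hpos v hv).ne' this
    have hw : w = 0 := by
      by_contra hw
      have := congrArg Complex.im (h w)
      simp [hreal] at this
      exact (hpos w hw).ne' this
    simp [hv, hw]
  exact (LinearMap.injective_iff_surjective_of_finrank_eq_finrank
    (Subspace.dual_finrank_eq (K := ℂ) (V := V)).symm).mp hinj

section RealSlice

variable {V : Type*} [NormedAddCommGroup V] [NormedSpace ℂ V]
  {E : Type*} [NormedAddCommGroup E] [NormedSpace ℝ E]

lemma hasLineDerivAt_cexp_neg_bilin (B : V →ₗ[ℂ] V →ₗ[ℂ] ℂ) (hsymm : ∀ x y : V, B x y = B y x)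
    (f : E →ₗ[ℝ] V) (x v : E) :
    HasLineDerivAt ℝ (fun x => Complex.exp (-(B (f x) (f x)) / 2))
      (-(B (f x) (f v) * Complex.exp (-(B (f x) (f x)) / 2))) x v := by
  have hre : ∀ t : ℝ, B (f (x + t • v)) (f (x + t • v)) =
      B (f x) (f x) + 2 * t * B (f x) (f v) + (t : ℂ) ^ 2 * B (f v) (f v) := fun t => by
    simp [hsymm (f v) (f x)]
    ring
  unfold HasLineDerivAt
  simp only [hre]
  have ht : HasDerivAt (fun t : ℝ => (t : ℂ)) 1 0 := Complex.ofRealCLM.hasDerivAt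
  have := (((((ht.const_mul (2 : ℂ)).mul_const (B (f x) (f v))).const_add
    (B (f x) (f x))).add ((ht.pow 2).mul_const (B (f v) (f v)))).neg.div_const 2).cexp
  convert! this using 1
  simp
  ring

lemma hasLineDerivAt_prod {ι : Type*} [DecidableEq ι] (f : E →ₗ[ℝ] V)
    (s : Finset ι) (ℓ : ι → V →ₗ[ℂ] ℂ) (x v : E) :
    HasLineDerivAt ℝ (fun x => ∏ i ∈ s, ℓ i (f x))
      (∑ i ∈ s, ℓ i (f v) * ∏ j ∈ s.erase i, ℓ j (f x)) x v := by
  have ht : HasDerivAt (fun t : ℝ => (t : ℂ)) 1 0 := Complex.ofRealCLM.hasDerivAt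
  have hi : ∀ i ∈ s, HasDerivAt (fun t : ℝ => ℓ i (f (x + t • v))) (ℓ i (f v)) 0 := fun i _ => by
    simpa using (ht.mul_const (ℓ i (f v))).const_add (ℓ i (f x))
  have := HasDerivAt.fun_finsetProd hi
  unfold HasLineDerivAt
  convert! this using 1
  simp [mul_comm]

variable [FiniteDimensional ℝ E]

/-- A continuous, quadratically homogeneous, positive function on a finite-dimensional real normed
space is coercive. -/
lemma exists_mul_norm_sq_le_of_homogeneous (q : E → ℝ) (hcont : Continuous q)
    (hhom : ∀ (t : ℝ) x, q (t • x) = t ^ 2 * q x) (hpos : ∀ x, x ≠ 0 → 0 < q x) :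
    ∃ c : ℝ, 0 < c ∧ ∀ x, c * ‖x‖ ^ 2 ≤ q x := by
  have hzero : q 0 = 0 := by simpa using hhom 0 0
  rcases (Metric.sphere (0 : E) 1).eq_empty_or_nonempty with hempty | hne
  · refine ⟨1, one_pos, fun x => ?_⟩
    have hx : x = 0 := by
      by_contra hx
      have : ‖x‖⁻¹ • x ∈ Metric.sphere (0 : E) 1 := by
        simp [norm_smul, norm_ne_zero_iff.mpr hx]
      simp [hempty] at this
    simp [hx, hzero]
  · obtain ⟨y, hy, hmin⟩ := (isCompact_sphere (0 : E) 1).exists_isMinOn hne hcont.continuousOn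
    refine ⟨q y, hpos y fun h => by simp [h] at hy, fun x => ?_⟩
    rcases eq_or_ne x 0 with rfl | hx
    · simp [hzero]
    have hx' : ‖x‖ ≠ 0 := norm_ne_zero_iff.mpr hx
    have hmem : ‖x‖⁻¹ • x ∈ Metric.sphere (0 : E) 1 := by simp [norm_smul, hx']
    have hle : q y ≤ q (‖x‖⁻¹ • x) := hmin hmem
    calc q y * ‖x‖ ^ 2 ≤ q (‖x‖⁻¹ • x) * ‖x‖ ^ 2 := by gcongr
      _ = q x := by rw [hhom]; field_simp

/-- A Gaussian factor dominates every power of `1 + t`. -/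
lemma exists_one_add_pow_mul_exp_neg_le {c : ℝ} (hc : 0 < c) (m : ℕ) :
    ∃ C : ℝ, ∀ t : ℝ, 0 ≤ t → (1 + t) ^ m * Real.exp (-(c * t ^ 2)) ≤ C := by
  refine ⟨m.factorial * Real.exp (1 + 1 / (4 * c)), fun t ht => ?_⟩
  have h1 : (1 + t) ^ m ≤ m.factorial * Real.exp (1 + t) := by
    have := Real.pow_div_factorial_le_exp (x := 1 + t) (by linarith) m
    rwa [div_le_iff₀ (by positivity), mul_comm] at this
  have h2 : (1 + t) + -(c * t ^ 2) ≤ 1 + 1 / (4 * c) := by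
    have h : 1 / (4 * c) - t + c * t ^ 2 = (2 * c * t - 1) ^ 2 / (4 * c) := by
      field_simp
      ring
    have : 0 ≤ (2 * c * t - 1) ^ 2 / (4 * c) := by positivity
    linarith
  calc (1 + t) ^ m * Real.exp (-(c * t ^ 2))
      ≤ m.factorial * Real.exp (1 + t) * Real.exp (-(c * t ^ 2)) := by gcongr
    _ = m.factorial * Real.exp ((1 + t) + -(c * t ^ 2)) := by rw [Real.exp_add (1 + t), mul_assoc]
    _ ≤ _ := by gcongr

lemma continuous_bilin_comp [FiniteDimensional ℂ V] (B : V →ₗ[ℂ] V →ₗ[ℂ] ℂ) (f : E →ₗ[ℝ] V) :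
    Continuous fun x => B (f x) (f x) := by
  let B' : V →ₗ[ℂ] V →L[ℂ] ℂ := LinearMap.toContinuousLinearMap.toLinearMap ∘ₗ B
  have hB' : Continuous B' := B'.continuous_of_finiteDimensional
  have hf : Continuous f := f.continuous_of_finiteDimensional
  exact (hB'.comp hf).clm_apply hf

variable [MeasurableSpace E] [BorelSpace E] (μ : Measure E) [μ.IsAddHaarMeasure]

/-- Polynomials are integrable against a Gaussian density. -/
lemma integrable_prod_mul_cexp_neg_bilin [FiniteDimensional ℂ V] {ι : Type*}
    (B : V →ₗ[ℂ] V →ₗ[ℂ] ℂ) (f : E →ₗ[ℝ] V)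
    (hpos : ∀ x, x ≠ 0 → 0 < (B (f x) (f x)).re) (s : Finset ι) (ℓ : ι → V →ₗ[ℂ] ℂ) :
    Integrable (fun x => (∏ i ∈ s, ℓ i (f x)) * Complex.exp (-(B (f x) (f x)) / 2)) μ := by
  have hcont := continuous_bilin_comp B f
  have hℓ : ∀ i, Continuous fun x => ℓ i (f x) := fun i =>
    (ℓ i).continuous_of_finiteDimensional.comp f.continuous_of_finiteDimensional
  obtain ⟨c, hc, hcoer⟩ := exists_mul_norm_sq_le_of_homogeneous
    (fun x => (B (f x) (f x)).re) (Complex.continuous_re.comp hcont)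
    (fun t x => by simp [pow_two, mul_assoc]) hpos
  let L : ι → E →L[ℝ] ℂ := fun i =>
    LinearMap.toContinuousLinearMap (((ℓ i).restrictScalars ℝ) ∘ₗ f)
  have hL : ∀ i x, ‖ℓ i (f x)‖ ≤ ‖L i‖ * (1 + ‖x‖) := fun i x =>
    ((L i).le_opNorm x).trans (by gcongr; linarith)
  obtain ⟨C, hC⟩ := exists_one_add_pow_mul_exp_neg_le (half_pos hc)
    (s.card + (Module.finrank ℝ E + 1))
  have hjap : Integrable (fun x : E => (1 + ‖x‖) ^ (-((Module.finrank ℝ E + 1 : ℕ) : ℝ))) μ :=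
    integrable_one_add_norm (by push_cast; linarith)
  refine (hjap.const_mul ((∏ i ∈ s, ‖L i‖) * C)).mono' ?_ (.of_forall fun x => ?_)
  · exact ((continuous_finsetProd s fun i _ => hℓ i).mul
      (Complex.continuous_exp.comp (hcont.neg.div_const 2))).aestronglyMeasurable
  have h0 : (0 : ℝ) < 1 + ‖x‖ := by positivity
  rw [Real.rpow_neg h0.le, Real.rpow_natCast, norm_mul, norm_prod, Complex.norm_exp]
  have hprod : ∏ i ∈ s, ‖ℓ i (f x)‖ ≤ (∏ i ∈ s, ‖L i‖) * (1 + ‖x‖) ^ s.card := by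
    rw [← Finset.prod_const, ← Finset.prod_mul_distrib]
    exact Finset.prod_le_prod (fun _ _ => norm_nonneg _) fun i _ => hL i x
  have hexp : (-(B (f x) (f x)) / 2).re ≤ -(c / 2 * ‖x‖ ^ 2) := by
    have h := hcoer x
    have : (-(B (f x) (f x)) / 2).re = -(B (f x) (f x)).re / 2 := by simp
    rw [this]
    linarith
  calc (∏ i ∈ s, ‖ℓ i (f x)‖) * Real.exp (-(B (f x) (f x)) / 2).re
      ≤ (∏ i ∈ s, ‖L i‖) * (1 + ‖x‖) ^ s.card * Real.exp (-(c / 2 * ‖x‖ ^ 2)) := by gcongr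
    _ = (∏ i ∈ s, ‖L i‖) * ((1 + ‖x‖) ^ (s.card + (Module.finrank ℝ E + 1))
          * Real.exp (-(c / 2 * ‖x‖ ^ 2))) * ((1 + ‖x‖) ^ (Module.finrank ℝ E + 1))⁻¹ := by
        rw [pow_add]
        field_simp
    _ ≤ _ := by
        gcongr
        exact hC _ (norm_nonneg x)

/-- Gaussian integration by parts along a complex direction. -/
lemma integral_bilin_mul_prod_mul_cexp [FiniteDimensional ℂ V] {ι : Type*} [DecidableEq ι]
    (B : V →ₗ[ℂ] V →ₗ[ℂ] ℂ) (hsymm : ∀ x y : V, B x y = B y x) (f : E →ₗ[ℝ] V)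
    (hspan : Submodule.span ℂ (Set.range f) = ⊤)
    (hpos : ∀ x, x ≠ 0 → 0 < (B (f x) (f x)).re) (s : Finset ι) (ℓ : ι → V →ₗ[ℂ] ℂ) (u : V) :
    ∫ x, B u (f x) * ((∏ i ∈ s, ℓ i (f x)) * Complex.exp (-(B (f x) (f x)) / 2)) ∂μ =
      ∑ i ∈ s, ℓ i u *
        ∫ x, (∏ j ∈ s.erase i, ℓ j (f x)) * Complex.exp (-(B (f x) (f x)) / 2) ∂μ := by
  have hint : ∀ u, Integrable (fun x => B u (f x) *
      ((∏ i ∈ s, ℓ i (f x)) * Complex.exp (-(B (f x) (f x)) / 2))) μ := fun u => by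
    have := integrable_prod_mul_cexp_neg_bilin μ B f hpos (Finset.insertNone s)
      (fun o => o.elim (B u) ℓ)
    simpa [Finset.prod_insertNone, mul_assoc] using this
  have hu : u ∈ Submodule.span ℂ (Set.range f) := hspan ▸ Submodule.mem_top
  induction hu using Submodule.span_induction with
  | mem u hu =>
    obtain ⟨v, rfl⟩ := hu
    have hterm : ∀ i ∈ s, Integrable (fun x => ℓ i (f v) * ((∏ j ∈ s.erase i, ℓ j (f x)) *
        Complex.exp (-(B (f x) (f x)) / 2))) μ := fun i _ =>
      (integrable_prod_mul_cexp_neg_bilin μ B f hpos _ ℓ).const_mul _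
    have hibp := integral_bilinear_hasLineDerivAt_right_eq_neg_left_of_integrable
      (μ := μ) (v := v) (B := ContinuousLinearMap.mul ℝ ℂ)
      (f := fun x => ∏ i ∈ s, ℓ i (f x))
      (g := fun x => Complex.exp (-(B (f x) (f x)) / 2))
      (f' := fun x => ∑ i ∈ s, ℓ i (f v) * ∏ j ∈ s.erase i, ℓ j (f x))
      (g' := fun x => -(B (f x) (f v) * Complex.exp (-(B (f x) (f x)) / 2)))
      (by
        simp only [ContinuousLinearMap.mul_apply', Finset.sum_mul, mul_assoc]
        exact integrable_finsetSum _ hterm)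
      (by
        refine (hint (f v)).neg.congr (.of_forall fun x => ?_)
        simp [hsymm (f v) (f x)]
        ring)
      (integrable_prod_mul_cexp_neg_bilin μ B f hpos s ℓ)
      (fun x _ => hasLineDerivAt_prod f s ℓ x v)
      (fun x _ => hasLineDerivAt_cexp_neg_bilin B hsymm f x v)
    simp only [ContinuousLinearMap.mul_apply', Finset.sum_mul, mul_assoc, mul_neg,
      integral_neg, neg_inj] at hibp
    rw [integral_finsetSum _ hterm] at hibp
    simp only [integral_const_mul] at hibp
    rw [← hibp]
    refine integral_congr_ae (.of_forall fun x => ?_)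
    simp only [hsymm (f v) (f x)]
    ring
  | zero => simp
  | add a b _ _ ha hb =>
    simp only [map_add, LinearMap.add_apply, add_mul, Finset.sum_add_distrib]
    rw [integral_add (hint a) (hint b), ha, hb]
  | smul c a _ ha =>
    simp only [map_smul, LinearMap.smul_apply, smul_eq_mul, mul_assoc, integral_const_mul, ha,
      Finset.mul_sum]

lemma integral_cexp_neg_bilin_ne_zero [FiniteDimensional ℂ V]
    (B : V →ₗ[ℂ] V →ₗ[ℂ] ℂ) (f : E →ₗ[ℝ] V)
    (hreal : ∀ x y, (B (f x) (f y)).im = 0)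
    (hpos : ∀ x, x ≠ 0 → 0 < (B (f x) (f x)).re) :
    ∫ x, Complex.exp (-(B (f x) (f x)) / 2) ∂μ ≠ 0 := by
  have heq : ∀ x, Complex.exp (-(B (f x) (f x)) / 2) =
      (Real.exp (-(B (f x) (f x)).re / 2) : ℂ) := fun x => by
    have : B (f x) (f x) = ((B (f x) (f x)).re : ℂ) := Complex.ext rfl (by simp [hreal])
    rw [this]
    push_cast
    simp
  have hint : Integrable (fun x => Complex.exp (-(B (f x) (f x)) / 2)) μ := by
    simpa using integrable_prod_mul_cexp_neg_bilin μ B f hpos (∅ : Finset ℕ) 0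
  simp only [heq] at hint ⊢
  rw [integral_complex_ofReal]
  exact_mod_cast (integral_exp_pos (μ := μ) (by exact_mod_cast hint.re)).ne'

end RealSlice

/-- Normalised Gaussian moments do not depend on the real slice. -/
lemma gaussian_moment_eq_of_real_slices {V : Type*} [NormedAddCommGroup V] [NormedSpace ℂ V]
    [FiniteDimensional ℂ V] {E F : Type*}
    [NormedAddCommGroup E] [NormedSpace ℝ E] [FiniteDimensional ℝ E]
    [MeasurableSpace E] [BorelSpace E]
    [NormedAddCommGroup F] [NormedSpace ℝ F] [FiniteDimensional ℝ F]
    [MeasurableSpace F] [BorelSpace F]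
    (μ : Measure E) [μ.IsAddHaarMeasure] (ν : Measure F) [ν.IsAddHaarMeasure]
    (B : V →ₗ[ℂ] V →ₗ[ℂ] ℂ) (hsymm : ∀ x y : V, B x y = B y x)
    (f : E →ₗ[ℝ] V) (g : F →ₗ[ℝ] V)
    (hfspan : Submodule.span ℂ (Set.range f) = ⊤)
    (hgspan : Submodule.span ℂ (Set.range g) = ⊤)
    (hfreal : ∀ x y, (B (f x) (f y)).im = 0)
    (hgreal : ∀ x y, (B (g x) (g y)).im = 0)
    (hfpos : ∀ x, x ≠ 0 → 0 < (B (f x) (f x)).re)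
    (hgpos : ∀ x, x ≠ 0 → 0 < (B (g x) (g x)).re)
    {ι : Type*} (s : Finset ι) (ℓ : ι → V →ₗ[ℂ] ℂ) :
    (∫ x, (∏ i ∈ s, ℓ i (f x)) * Complex.exp (-(B (f x) (f x)) / 2) ∂μ)
        / (∫ x, Complex.exp (-(B (f x) (f x)) / 2) ∂μ)
      = (∫ x, (∏ i ∈ s, ℓ i (g x)) * Complex.exp (-(B (g x) (g x)) / 2) ∂ν)
        / (∫ x, Complex.exp (-(B (g x) (g x)) / 2) ∂ν) := by
  classical
  induction s using Finset.strongInduction with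
  | H s ih =>
    rcases s.eq_empty_or_nonempty with rfl | ⟨a, ha⟩
    · simp only [Finset.prod_empty, one_mul]
      rw [div_self (integral_cexp_neg_bilin_ne_zero μ B f hfreal hfpos),
        div_self (integral_cexp_neg_bilin_ne_zero ν B g hgreal hgpos)]
    · obtain ⟨u, hu⟩ := bilin_surjective_of_pos B f hfspan hfreal hfpos (ℓ a)
      simp only [← Finset.mul_prod_erase s _ ha, ← hu, mul_assoc]
      rw [integral_bilin_mul_prod_mul_cexp μ B hsymm f hfspan hfpos,
        integral_bilin_mul_prod_mul_cexp ν B hsymm g hgspan hgpos, Finset.sum_div, Finset.sum_div]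
      refine Finset.sum_congr rfl fun i _ => ?_
      rw [mul_div_assoc, mul_div_assoc, ih _ ((Finset.erase_subset _ _).trans_ssubset
        (Finset.erase_ssubset ha))]

/-- independence of Gaussian moments of the choice of real slice.
`V` is a finite-dimensional complex vector space, `B` a symmetric complex-bilinear
form.  A real slice is presented by an injective `ℝ`-linear parametrisation
`f : ℝⁿ → V` whose image spans `V` over `ℂ` and meets `i·(image)` only in `0`.
If `B` is real-valued and positive definite on each of two real slices, then for any
complex-linear functionals `ℓ₁, …, ℓ_k` and any Haar (Lebesgue) measures on the two
slices, all the Gaussian integrals converge and the normalised moments agree. -/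
theorem statement15
    {V : Type*} [NormedAddCommGroup V] [NormedSpace ℂ V] [FiniteDimensional ℂ V]
    (B : V →ₗ[ℂ] V →ₗ[ℂ] ℂ) (hsymm : ∀ x y : V, B x y = B y x)
    (k : ℕ) (ℓ : Fin k → (V →ₗ[ℂ] ℂ))
    (n₁ n₂ : ℕ)
    (f₁ : (Fin n₁ → ℝ) →ₗ[ℝ] V) (f₂ : (Fin n₂ → ℝ) →ₗ[ℝ] V)
    (hf₁inj : Function.Injective f₁) (hf₂inj : Function.Injective f₂)
    (hf₁span : Submodule.span ℂ (Set.range f₁) = ⊤)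
    (hf₂span : Submodule.span ℂ (Set.range f₂) = ⊤)
    (hf₁real : ∀ x y, f₁ x = Complex.I • f₁ y → f₁ x = 0)
    (hf₂real : ∀ x y, f₂ x = Complex.I • f₂ y → f₂ x = 0)
    (hB₁real : ∀ x y, (B (f₁ x) (f₁ y)).im = 0)
    (hB₂real : ∀ x y, (B (f₂ x) (f₂ y)).im = 0)
    (hB₁pos : ∀ x, x ≠ 0 → 0 < (B (f₁ x) (f₁ x)).re)
    (hB₂pos : ∀ x, x ≠ 0 → 0 < (B (f₂ x) (f₂ x)).re)
    (μ₁ : Measure (Fin n₁ → ℝ)) [μ₁.IsAddHaarMeasure]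
    (μ₂ : Measure (Fin n₂ → ℝ)) [μ₂.IsAddHaarMeasure] :
    Integrable (fun x => (∏ i, ℓ i (f₁ x)) * Complex.exp (-(B (f₁ x) (f₁ x)) / 2)) μ₁
    ∧ Integrable (fun x => Complex.exp (-(B (f₁ x) (f₁ x)) / 2)) μ₁
    ∧ Integrable (fun x => (∏ i, ℓ i (f₂ x)) * Complex.exp (-(B (f₂ x) (f₂ x)) / 2)) μ₂
    ∧ Integrable (fun x => Complex.exp (-(B (f₂ x) (f₂ x)) / 2)) μ₂
    ∧ (∫ x, (∏ i, ℓ i (f₁ x)) * Complex.exp (-(B (f₁ x) (f₁ x)) / 2) ∂μ₁)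
        / (∫ x, Complex.exp (-(B (f₁ x) (f₁ x)) / 2) ∂μ₁)
      = (∫ x, (∏ i, ℓ i (f₂ x)) * Complex.exp (-(B (f₂ x) (f₂ x)) / 2) ∂μ₂)
        / (∫ x, Complex.exp (-(B (f₂ x) (f₂ x)) / 2) ∂μ₂) := by
  have h₁ := integrable_prod_mul_cexp_neg_bilin μ₁ B f₁ hB₁pos (ι := Fin k)
  have h₂ := integrable_prod_mul_cexp_neg_bilin μ₂ B f₂ hB₂pos (ι := Fin k)
  refine ⟨h₁ Finset.univ ℓ, by simpa using h₁ ∅ ℓ, h₂ Finset.univ ℓ, by simpa using h₂ ∅ ℓ, ?_⟩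
  exact gaussian_moment_eq_of_real_slices μ₁ μ₂ B hsymm f₁ f₂ hf₁span hf₂span hB₁real hB₂real
    hB₁pos hB₂pos Finset.univ ℓ
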